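/- For every graph G and every k ≥ 1, b_g(G) ≤ 2·γ_k(G) + k − 1 and b_g'(G) ≤ 2·γ_k(G) + k, where γ_k(G) is the distance k-domination number of G. -/

import Mathlib

namespace BurningGame

/-- One spreading phase: all neighbors of burned vertices become burned. -/
noncomputable def spread {V : Type*} [Fintype V] [DecidableEq V] (G : SimpleGraph V) (B : Finset V) : Finset V :=
  ((↑B : Set V) ∪ {v | ∃ u ∈ B, G.Adj u v}).toFinite.toFinset

/-- `EndBy G turn i B k`: starting from burned set `B` at round index `i`
(the player selecting in round `i` is Burner iff `turn i = true`; Burner's selections are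
quantified existentially, Staller's universally), Burner can force the game to end
within `k` further rounds. -/
def EndBy {V : Type*} [Fintype V] [DecidableEq V] (G : SimpleGraph V) (turn : ℕ → Bool) :
    ℕ → Finset V → ℕ → Prop
  | _, B, 0 => B = Finset.univ
  | i, B, k + 1 => B = Finset.univ ∨
      spread G B = Finset.univ ∨
      (if turn i then ∃ v ∉ spread G B, EndBy G turn (i + 1) (insert v (spread G B)) k
       else ∀ v ∉ spread G B, EndBy G turn (i + 1) (insert v (spread G B)) k)

/-- Game burning number relative to a preburned set `S` (Burner starts). -/
noncomputable def bgRel {V : Type*} [Fintype V] [DecidableEq V] (G : SimpleGraph V) (S : Finset V) : ℕ :=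
  sInf {k | EndBy G (fun i => i % 2 == 0) 0 S k}

/-- The game burning number (Burner starts). -/
noncomputable def bg {V : Type*} [Fintype V] [DecidableEq V] (G : SimpleGraph V) : ℕ := bgRel G ∅

/-- The Staller-start game burning number. -/
noncomputable def bg' {V : Type*} [Fintype V] [DecidableEq V] (G : SimpleGraph V) : ℕ :=
  sInf {k | EndBy G (fun i => i % 2 == 1) 0 ∅ k}

/-- The burning number: only Burner plays. -/
noncomputable def burn {V : Type*} [Fintype V] [DecidableEq V] (G : SimpleGraph V) : ℕ :=
  sInf {k | EndBy G (fun _ => true) 0 ∅ k}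

/-- The cooling number: only Staller plays. -/
noncomputable def cool {V : Type*} [Fintype V] [DecidableEq V] (G : SimpleGraph V) : ℕ :=
  sInf {k | EndBy G (fun _ => false) 0 ∅ k}


/-- The distance `k`-domination number: minimum size of a set `S` such that every
vertex is within distance `k` of some vertex of `S`. -/
noncomputable def kdomNum {V : Type*} [Fintype V] (G : SimpleGraph V) (k : ℕ) : ℕ :=
  sInf {m | ∃ S : Finset V, S.card = m ∧
    ∀ v : V, ∃ u ∈ S, ∃ p : G.Walk u v, p.length ≤ k}

section

variable {V : Type*} [Fintype V] [DecidableEq V] {G : SimpleGraph V} {turn : ℕ → Bool}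

lemma subset_spread (B : Finset V) : B ⊆ spread G B := fun v hv => by
  simp [spread, hv]

lemma mem_spread_of_adj {B : Finset V} {u v : V} (hu : u ∈ B) (h : G.Adj u v) :
    v ∈ spread G B := by
  simp only [spread, Set.Finite.mem_toFinset, Set.mem_union, Set.mem_ofPred_eq]
  exact Or.inr ⟨u, hu, h⟩

/-- To end within `n + 1` rounds it is enough, unless spreading ends the game, that Burner has
one good selection in his rounds and that every selection of Staller is good in hers. -/
lemma endBy_succ {i n : ℕ} {B : Finset V}
    (hb : turn i = true → spread G B ≠ Finset.univ →
      ∃ v ∉ spread G B, EndBy G turn (i + 1) (insert v (spread G B)) n)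
    (hs : turn i = false → ∀ v, EndBy G turn (i + 1) (insert v (spread G B)) n) :
    EndBy G turn i B (n + 1) := by
  by_cases h : spread G B = Finset.univ
  · exact Or.inr (Or.inl h)
  · refine Or.inr (Or.inr ?_)
    split_ifs with ht
    · exact hb ht h
    · exact fun v _ => hs (by simpa using ht) v

/-- If every vertex is within distance `n` of a burned vertex, the game ends within `n` rounds,
no matter how it is played. -/
lemma endBy_of_forall_walk {n : ℕ} (i : ℕ) {B : Finset V}
    (h : ∀ v, ∃ u ∈ B, ∃ p : G.Walk u v, p.length ≤ n) : EndBy G turn i B n := by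
  induction n generalizing i B with
  | zero =>
    refine Finset.eq_univ_of_forall fun v => ?_
    obtain ⟨u, hu, p, hp⟩ := h v
    exact SimpleGraph.Walk.eq_of_length_eq_zero (Nat.le_zero.mp hp) ▸ hu
  | succ n ih =>
    have next (w : V) : EndBy G turn (i + 1) (insert w (spread G B)) n := by
      refine ih _ fun v => ?_
      obtain ⟨u, hu, p, hp⟩ := h v
      cases p with
      | nil => exact ⟨v, Finset.mem_insert_of_mem (subset_spread B hu), .nil, Nat.zero_le n⟩
      | cons hadj q =>
        exact ⟨_, Finset.mem_insert_of_mem (mem_spread_of_adj hu hadj), q, by simpa using hp⟩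
    refine endBy_succ (fun _ hne => ?_) fun _ => next
    obtain ⟨v, hv⟩ := not_forall.mp (mt Finset.eq_univ_of_forall hne)
    exact ⟨v, hv, next v⟩

lemma card_sdiff_insert_spread_le (S B : Finset V) (v : V) :
    (S \ insert v (spread G B)).card ≤ (S \ B).card :=
  Finset.card_le_card <| Finset.sdiff_subset_sdiff subset_rfl <|
    (subset_spread B).trans (Finset.subset_insert _ _)

/-- Burner can reduce the number of unburned vertices of `S` in each of his rounds. -/
lemma exists_card_sdiff_insert_spread_le {S B : Finset V} {m : ℕ} (hS : (S \ B).card ≤ m + 1)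
    (h : spread G B ≠ Finset.univ) :
    ∃ v ∉ spread G B, (S \ insert v (spread G B)).card ≤ m := by
  by_cases hsub : S ⊆ spread G B
  · obtain ⟨v, hv⟩ := not_forall.mp (mt Finset.eq_univ_of_forall h)
    refine ⟨v, hv, ?_⟩
    simp [Finset.sdiff_eq_empty_iff_subset.mpr (hsub.trans (Finset.subset_insert v _))]
  · obtain ⟨v, hvS, hv⟩ := Finset.not_subset.mp hsub
    refine ⟨v, hv, Nat.le_of_lt_succ (lt_of_lt_of_le (Finset.card_lt_card ?_) hS)⟩
    refine Finset.ssubset_iff_of_subset (Finset.sdiff_subset_sdiff subset_rfl <|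
      (subset_spread B).trans (Finset.subset_insert _ _)) |>.mpr ⟨v, ?_, by simp⟩
    exact Finset.mem_sdiff.mpr ⟨hvS, fun hB => hv (subset_spread B hB)⟩

/-- Burner to move, with at most `m + 1` unburned vertices in a distance `k`-dominating set. -/
lemma endBy_of_card_sdiff_le {S : Finset V} {k : ℕ} (hturn : ∀ i, turn (i + 1) = !turn i)
    (hS : ∀ v, ∃ u ∈ S, ∃ p : G.Walk u v, p.length ≤ k) {m i : ℕ} {B : Finset V}
    (hi : turn i = true) (hB : (S \ B).card ≤ m + 1) : EndBy G turn i B (2 * m + k + 1) := by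
  induction m generalizing i B with
  | zero =>
    refine endBy_succ (fun _ hne => ?_) (by simp [hi])
    obtain ⟨v, hv, hcard⟩ := exists_card_sdiff_insert_spread_le hB hne
    rw [Nat.le_zero, Finset.card_eq_zero, Finset.sdiff_eq_empty_iff_subset] at hcard
    rw [Nat.mul_zero, Nat.zero_add]
    refine ⟨v, hv, endBy_of_forall_walk _ fun w => ?_⟩
    obtain ⟨u, hu, p⟩ := hS w
    exact ⟨u, hcard hu, p⟩
  | succ m ih =>
    refine endBy_succ (fun _ hne => ?_) (by simp [hi])
    obtain ⟨v, hv, hcard⟩ := exists_card_sdiff_insert_spread_le hB hne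
    refine ⟨v, hv, ?_⟩
    rw [show 2 * (m + 1) + k = 2 * m + k + 1 + 1 by ring]
    exact endBy_succ (by simp [hturn, hi]) fun _ w =>
      ih (by simp [hturn, hi]) ((card_sdiff_insert_spread_le S _ w).trans hcard)

end

lemma exists_card_eq_kdomNum {V : Type*} [Fintype V] (G : SimpleGraph V) (k : ℕ) :
    ∃ S : Finset V, S.card = kdomNum G k ∧ ∀ v, ∃ u ∈ S, ∃ p : G.Walk u v, p.length ≤ k :=
  Nat.sInf_mem (s := {m | ∃ S : Finset V, S.card = m ∧
      ∀ v, ∃ u ∈ S, ∃ p : G.Walk u v, p.length ≤ k})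
    ⟨_, Finset.univ, rfl, fun v => ⟨v, Finset.mem_univ v, .nil, by simp⟩⟩

theorem stmt14 {V : Type*} [Fintype V] [DecidableEq V] (G : SimpleGraph V)
    (k : ℕ) (hk : 1 ≤ k) :
    bg G ≤ 2 * kdomNum G k + k - 1 ∧ bg' G ≤ 2 * kdomNum G k + k := by
  obtain ⟨S, hcard, hS⟩ := exists_card_eq_kdomNum G k
  rw [← hcard]
  rcases hc : S.card with _ | m
  · obtain rfl := Finset.card_eq_zero.mp hc
    exact ⟨Nat.sInf_le (endBy_of_forall_walk _ fun v => by simpa using hS v),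
      Nat.sInf_le (endBy_of_forall_walk _ fun v => by simpa using hS v)⟩
  constructor
  · rw [show 2 * (m + 1) + k - 1 = 2 * m + k + 1 by omega]
    have h : EndBy G (fun i => i % 2 == 0) 0 ∅ (2 * m + k + 1) :=
      endBy_of_card_sdiff_le (fun i => by grind) hS rfl (by simp [hc])
    exact Nat.sInf_le h
  · rw [show 2 * (m + 1) + k = 2 * m + k + 1 + 1 by ring]
    have h : EndBy G (fun i => i % 2 == 1) 0 ∅ (2 * m + k + 1 + 1) :=
      endBy_succ (by simp) fun _ w => endBy_of_card_sdiff_le (fun i => by grind) hS rfl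
        ((card_sdiff_insert_spread_le S _ w).trans (by simp [hc]))
    exact Nat.sInf_le h

end BurningGame
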